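/- Let P and Q be orthogonal projections onto closed subspaces 𝒫 and 𝒬 of a Hilbert space H. Then 𝒫 + 𝒬 is a closed subspace of H if and only if there exists 0 < ε < 1 such that the spectrum of PQP is disjoint from the open interval (ε, 1). -/

import Mathlib

open ContinuousLinearMap in
/-- A self-adjoint operator that is bounded below is invertible. -/
theorem IsSelfAdjoint.isUnit_of_bound {E : Type*} [NormedAddCommGroup E]
    [InnerProductSpace ℂ E] [CompleteSpace E] {A : E →L[ℂ] E} (hA : IsSelfAdjoint A)
    {C : ℝ} (hC : ∀ x, ‖x‖ ≤ C * ‖A x‖) : IsUnit A := by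
  have hanti : AntilipschitzWith C.toNNReal A := A.antilipschitz_of_bound fun x ↦
    (hC x).trans (by gcongr; exact Real.le_coe_toNNReal C)
  rw [isUnit_iff_bijective, bijective_iff_dense_range_and_antilipschitz]
  refine ⟨?_, _, hanti⟩
  rw [Submodule.topologicalClosure_eq_top_iff, orthogonal_range, hA.adjoint_eq]
  exact LinearMap.ker_eq_bot.mpr hanti.injective

/-- An operator with closed range satisfies `‖T x‖ ≤ K * ‖T† (T x)‖`. -/
theorem ContinuousLinearMap.exists_norm_apply_le_of_isClosed_range {E F : Type*}
    [NormedAddCommGroup E] [InnerProductSpace ℂ E] [CompleteSpace E]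
    [NormedAddCommGroup F] [InnerProductSpace ℂ F] [CompleteSpace F] (T : E →L[ℂ] F)
    (hT : IsClosed (T.range : Set F)) :
    ∃ K > 0, ∀ x, ‖T x‖ ≤ K * ‖adjoint T (T x)‖ := by
  have := hT.completeSpace_coe
  obtain ⟨K, hK, hpre⟩ := T.rangeRestrict.exists_preimage_norm_le
    (LinearMap.surjective_rangeRestrict T.toLinearMap)
  refine ⟨K, hK, fun x ↦ ?_⟩
  obtain ⟨z, hz, hzK⟩ := hpre ⟨T x, x, rfl⟩
  have hz : T z = T x := congrArg Subtype.val hz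
  have hzK : ‖z‖ ≤ K * ‖T x‖ := hzK
  have hsq : ‖T x‖ ^ 2 ≤ ‖z‖ * ‖adjoint T (T x)‖ := by
    have h := re_inner_le_norm (𝕜 := ℂ) z (adjoint T (T x))
    rwa [adjoint_inner_right, hz, inner_self_eq_norm_sq] at h
  rcases (norm_nonneg (T x)).eq_or_lt with h0 | hpos
  · rw [← h0]; positivity
  · refine le_of_mul_le_mul_left ?_ hpos
    calc ‖T x‖ * ‖T x‖ = ‖T x‖ ^ 2 := (sq _).symm
      _ ≤ ‖z‖ * ‖adjoint T (T x)‖ := hsq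
      _ ≤ K * ‖T x‖ * ‖adjoint T (T x)‖ := by gcongr
      _ = ‖T x‖ * (K * ‖adjoint T (T x)‖) := by ring

/-- If `‖T x‖ ≤ K * ‖T† (T x)‖` for all `x`, then `T† T` has no spectrum in `(0, K⁻²)`. -/
theorem ContinuousLinearMap.notMem_spectrum_star_mul_self {E : Type*}
    [NormedAddCommGroup E] [InnerProductSpace ℂ E] [CompleteSpace E] (T : E →L[ℂ] E) {K : ℝ}
    (hT : ∀ x, ‖T x‖ ≤ K * ‖adjoint T (T x)‖) {t : ℝ} (ht0 : 0 < t) (ht : t * K ^ 2 < 1) :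
    t ∉ spectrum ℝ (star T * T) := by
  rw [spectrum.notMem_iff]
  have hsa : IsSelfAdjoint (algebraMap ℝ (E →L[ℂ] E) t - star T * T) :=
    (IsSelfAdjoint.algebraMap _ (IsSelfAdjoint.all t)).sub (IsSelfAdjoint.star_mul_self T)
  refine hsa.isUnit_of_bound (C := (1 + (1 - t * K ^ 2)⁻¹) / t) fun x ↦ ?_
  set w := (algebraMap ℝ (E →L[ℂ] E) t - star T * T) x with hw
  set s := adjoint T (T x) with hs
  have hws : s = (t : ℂ) • x - w := by
    simp [hw, hs, star_eq_adjoint, Algebra.algebraMap_eq_smul_one]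
  have hgap : 0 < 1 - t * K ^ 2 := by linarith
  have hTx : ‖T x‖ ^ 2 ≤ K ^ 2 * ‖s‖ ^ 2 := by
    rw [← mul_pow]; exact pow_le_pow_left₀ (norm_nonneg _) (hT x) 2
  have hsq : ‖s‖ ^ 2 ≤ t * ‖T x‖ ^ 2 + ‖w‖ * ‖s‖ := by
    have h1 : ‖s‖ ^ 2 = t * ‖T x‖ ^ 2 - RCLike.re (inner ℂ w s) := by
      have h2 : RCLike.re (inner ℂ x s) = ‖T x‖ ^ 2 := by
        rw [hs, adjoint_inner_right, inner_self_eq_norm_sq]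
      rw [← inner_self_eq_norm_sq (𝕜 := ℂ) s]
      nth_rewrite 1 [hws]
      rw [inner_sub_left, inner_smul_left, map_sub, ← h2]
      simp
    have h3 := (abs_le.mp ((RCLike.abs_re_le_norm _).trans (norm_inner_le_norm (𝕜 := ℂ) w s))).1
    linarith
  have hsw : ‖s‖ ≤ (1 - t * K ^ 2)⁻¹ * ‖w‖ := by
    rw [← div_eq_inv_mul, le_div_iff₀ hgap]
    rcases (norm_nonneg s).eq_or_lt with h0 | hpos
    · rw [← h0]; simp
    · refine le_of_mul_le_mul_right ?_ hpos
      nlinarith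
  have htx : t * ‖x‖ ≤ ‖s‖ + ‖w‖ := by
    calc t * ‖x‖ = ‖(t : ℂ) • x‖ := by rw [norm_smul]; simp [abs_of_pos ht0]
      _ = ‖s + w‖ := by rw [hws, sub_add_cancel]
      _ ≤ ‖s‖ + ‖w‖ := norm_add_le _ _
  rw [div_mul_eq_mul_div, le_div_iff₀ ht0]
  linarith

/-- If `T† T` has a spectral gap above `0`, then `T` has a bounded generalized inverse. -/
theorem ContinuousLinearMap.exists_mul_mul_self_of_spectral_gap {E : Type*}
    [NormedAddCommGroup E] [InnerProductSpace ℂ E] [CompleteSpace E] (T : E →L[ℂ] E) {δ : ℝ}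
    (hδ : 0 < δ) (hgap : ∀ t ∈ spectrum ℝ (star T * T), 0 < t → δ ≤ t) :
    ∃ G : E →L[ℂ] E, T * G * T = T := by
  set S := star T * T with hS
  have hSsa : IsSelfAdjoint S := IsSelfAdjoint.star_mul_self T
  set g := cfc (fun t : ℝ ↦ (max t δ)⁻¹) S with hg
  have hcont : Continuous fun t : ℝ ↦ (max t δ)⁻¹ :=
    (continuous_id.max continuous_const).inv₀ fun t ↦ (hδ.trans_le (le_max_right t δ)).ne'
  have hSgS : S * g * S = S := by
    have hid : cfc (fun t : ℝ ↦ t) S = S := cfc_id ℝ S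
    calc S * g * S = cfc (fun t : ℝ ↦ t * (max t δ)⁻¹ * t) S := by
          rw [cfc_mul _ _ S (by fun_prop) (by fun_prop),
            cfc_mul _ _ S (by fun_prop) hcont.continuousOn, hid]
      _ = cfc (fun t : ℝ ↦ t) S := cfc_congr fun t ht ↦ by
          rcases (spectrum_nonneg_of_nonneg (star_mul_self_nonneg T) ht).eq_or_lt with h0 | hpos
          · simp [← h0]
          · simp [max_eq_left (hgap t ht hpos), hpos.ne']
      _ = S := hid
  refine ⟨g * star T, ?_⟩
  have hzero : T * (g * S - 1) = 0 := by
    rw [← CStarRing.star_mul_self_eq_zero_iff]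
    calc star (T * (g * S - 1)) * (T * (g * S - 1))
        = star (g * S - 1) * (S * g * S - S) := by rw [star_mul, hS]; noncomm_ring
      _ = 0 := by rw [hSgS, sub_self, mul_zero]
  rw [mul_sub, mul_one, sub_eq_zero] at hzero
  simpa only [hS, mul_assoc] using hzero

/-- An operator with a bounded generalized inverse has closed range. -/
theorem ContinuousLinearMap.isClosed_range_of_mul_mul_self {E : Type*}
    [NormedAddCommGroup E] [NormedSpace ℂ E] {T G : E →L[ℂ] E} (h : T * G * T = T) :
    IsClosed (T.range : Set E) := by
  have hrange : (T.range : Set E) = {y | T (G y) = y} := by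
    ext y
    constructor
    · rintro ⟨x, rfl⟩
      exact congrArg (fun A : E →L[ℂ] E ↦ A x) h
    · exact fun hy ↦ ⟨G y, hy⟩
  rw [hrange]
  exact isClosed_eq (by fun_prop) continuous_id

/-- The range of `T` is closed iff `T† T` has a spectral gap above `0`. -/
theorem ContinuousLinearMap.isClosed_range_iff_spectral_gap {E : Type*}
    [NormedAddCommGroup E] [InnerProductSpace ℂ E] [CompleteSpace E] (T : E →L[ℂ] E) :
    IsClosed (T.range : Set E) ↔
      ∃ δ > 0, ∀ t ∈ spectrum ℝ (star T * T), 0 < t → δ ≤ t := by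
  constructor
  · intro hT
    obtain ⟨K, hK, hbound⟩ := T.exists_norm_apply_le_of_isClosed_range hT
    refine ⟨(K ^ 2)⁻¹, by positivity, fun t ht ht0 ↦ ?_⟩
    by_contra! hlt
    refine T.notMem_spectrum_star_mul_self hbound ht0 ?_ ht
    rwa [lt_inv_comm₀ ht0 (by positivity), ← one_div, lt_div_iff₀ ht0, mul_comm] at hlt
  · rintro ⟨δ, hδ, hgap⟩
    obtain ⟨G, hG⟩ := T.exists_mul_mul_self_of_spectral_gap hδ hgap
    exact isClosed_range_of_mul_mul_self hG

/-- For idempotent `Q`, the sum of the ranges of `P` and `Q` is closed iff the range of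
`(1 - Q) P` is. -/
theorem ContinuousLinearMap.isClosed_range_sup_range_iff {E : Type*}
    [NormedAddCommGroup E] [NormedSpace ℂ E] {P Q : E →L[ℂ] E} (hQ : Q * Q = Q) :
    IsClosed ((P.range ⊔ Q.range : Submodule ℂ E) : Set E) ↔
      IsClosed (((1 - Q) * P).range : Set E) := by
  have hQQ (x : E) : Q (Q x) = Q x := congrArg (fun A : E →L[ℂ] E ↦ A x) hQ
  have hpreimage : ((P.range ⊔ Q.range : Submodule ℂ E) : Set E) =
      (1 - Q : E →L[ℂ] E) ⁻¹' (((1 - Q) * P).range : Set E) := by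
    ext x
    simp only [SetLike.mem_coe, Set.mem_preimage, Submodule.mem_sup]
    constructor
    · rintro ⟨_, ⟨u, rfl⟩, _, ⟨v, rfl⟩, rfl⟩
      exact ⟨u, by simp [sub_apply, hQQ]⟩
    · rintro ⟨u, hu⟩
      have hu : P u - Q (P u) = x - Q x := by simpa [sub_apply] using hu
      refine ⟨P u, ⟨u, rfl⟩, Q (x - P u), ⟨_, rfl⟩, ?_⟩
      rw [map_sub, add_sub_left_comm, hu, add_sub_cancel]
  have hinter : (((1 - Q) * P).range : Set E) =
      ((P.range ⊔ Q.range : Submodule ℂ E) : Set E) ∩ {x | Q x = 0} := by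
    rw [hpreimage]
    ext x
    simp only [Set.mem_inter_iff, Set.mem_preimage, Set.mem_ofPred_eq]
    constructor
    · rintro ⟨u, rfl⟩
      have hQu : Q (((1 - Q) * P) u) = 0 := by simp [sub_apply, hQQ]
      refine ⟨⟨u, ?_⟩, hQu⟩
      simp [sub_apply, hQQ]
    · rintro ⟨hx, hQx⟩
      simpa [sub_apply, hQx] using hx
  constructor
  · intro h
    rw [hinter]
    exact h.inter (isClosed_eq Q.continuous continuous_const)
  · intro h
    rw [hpreimage]
    exact h.preimage (1 - Q : E →L[ℂ] E).continuous

/-- If `P` is idempotent, `A * P = A` and `t ≠ 0, 1`, the scalar `t` lies in the spectrum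
of `P - A` iff `1 - t` lies in the spectrum of `A`. -/
theorem spectrum.mem_sub_iff_of_idempotent {R : Type*} [Ring R] [Algebra ℝ R] {P A : R}
    (hP : P * P = P) (hAP : A * P = A) {t : ℝ} (ht0 : t ≠ 0) (ht1 : t ≠ 1) :
    t ∈ spectrum ℝ (P - A) ↔ 1 - t ∈ spectrum ℝ A := by
  have ht1' : 1 - t ≠ 0 := sub_ne_zero.mpr ht1.symm
  have hunit : IsUnit ((t / (1 - t)) • (1 - P) - P) := by
    refine isUnit_iff_exists.mpr ⟨((1 - t) / t) • (1 - P) - P, ?_, ?_⟩ <;>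
    · simp only [mul_sub, sub_mul, smul_mul_assoc, mul_smul_comm, mul_one, one_mul, hP, smul_smul,
        smul_sub]
      match_scalars <;> field_simp <;> ring
  have hfactor : algebraMap ℝ R t - (P - A) =
      (algebraMap ℝ R (1 - t) - A) * ((t / (1 - t)) • (1 - P) - P) := by
    simp only [Algebra.algebraMap_eq_smul_one, mul_sub, sub_mul, smul_mul_assoc, mul_smul_comm,
      mul_one, one_mul, hAP, smul_smul, smul_sub]
    match_scalars <;> field_simp
    all_goals ring
  rw [spectrum.mem_iff, spectrum.mem_iff, hfactor, ← hunit.unit_spec, Units.isUnit_mul_units]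

/-- For orthogonal projections `P` and `Q` on a Hilbert space with ranges `𝒫` and `𝒬`,
the linear span `𝒫 + 𝒬` is closed if and only if there is `0 < ε < 1` such that the
spectrum of `PQP` is disjoint from the open interval `(ε, 1)`. -/
theorem sum_closed_iff_spectral_gap {H : Type*} [NormedAddCommGroup H]
    [InnerProductSpace ℂ H] [CompleteSpace H] (P Q : H →L[ℂ] H)
    (hPsa : IsSelfAdjoint P) (hP2 : P * P = P)
    (hQsa : IsSelfAdjoint Q) (hQ2 : Q * Q = Q) :
    IsClosed ((LinearMap.range P.toLinearMap ⊔ LinearMap.range Q.toLinearMap :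
        Submodule ℂ H) : Set H)
      ↔ ∃ ε : ℝ, 0 < ε ∧ ε < 1 ∧ spectrum ℝ (P * Q * P) ∩ Set.Ioo ε 1 = ∅ := by
  rw [ContinuousLinearMap.isClosed_range_sup_range_iff hQ2,
    ContinuousLinearMap.isClosed_range_iff_spectral_gap]
  have hstar : star ((1 - Q) * P) * ((1 - Q) * P) = P - P * Q * P := by
    rw [star_mul, star_sub, star_one, hPsa.star_eq, hQsa.star_eq]
    calc P * (1 - Q) * ((1 - Q) * P) = P * P - P * Q * P - P * Q * P + P * (Q * Q) * P := by
          noncomm_ring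
      _ = P - P * Q * P := by rw [hP2, hQ2]; abel
  have hmem {t : ℝ} (ht0 : t ≠ 0) (ht1 : t ≠ 1) :
      t ∈ spectrum ℝ (P - P * Q * P) ↔ 1 - t ∈ spectrum ℝ (P * Q * P) :=
    spectrum.mem_sub_iff_of_idempotent hP2 (by rw [mul_assoc, hP2]) ht0 ht1
  rw [hstar]
  constructor
  · rintro ⟨δ, hδ, hgap⟩
    refine ⟨max (1 - δ) (1 / 2), by positivity, max_lt (by linarith) (by norm_num), ?_⟩
    rw [Set.eq_empty_iff_forall_notMem]
    rintro s ⟨hs, hεs, hs1⟩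
    obtain ⟨hδs, hs2⟩ := max_lt_iff.mp hεs
    have := hgap (1 - s) ((hmem (by linarith) (by linarith)).mpr (by rwa [sub_sub_cancel]))
      (by linarith)
    linarith
  · rintro ⟨ε, hε0, hε1, hgap⟩
    refine ⟨1 - ε, by linarith, fun t ht ht0 ↦ ?_⟩
    by_contra! hlt
    exact Set.eq_empty_iff_forall_notMem.mp hgap (1 - t)
      ⟨(hmem ht0.ne' (by linarith)).mp ht, by linarith, by linarith⟩
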